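/- arXiv:math/0405347 — 3 statements merged into one kernel-verified Lean document; each statement's English description precedes it below -/
import Mathlib

section
/- Let e ∈ {0, 2, 3, 4} and let a, b, c be integers with 0 ≤ a ≤ 6, ea ≤ b ≤ 3(e + 2), and 2(ab + a + b − c + 2) − ea(a + 1) ≥ 74. Set p = ⌊a/2⌋ + 1, q = ⌊b/2⌋ + 1, a' = a − 2p, b' = b − 2q, and c' = c + eap − aq − bp − ep² + 2pq. Then: (i) c' ≤ −2; (ii) if c' = −2 then a' = −1; (iii) if c' ≥ −3 then b' = −2. -/
theorem floor_intCast_div_two (n : ℤ) : ⌊(n : ℚ) / 2⌋ = n / 2 := by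
  exact_mod_cast Rat.floor_intCast_div_natCast n 2

theorem claim_surf_c2 (e a b c : ℤ) (he : e = 0 ∨ e = 2 ∨ e = 3 ∨ e = 4)
    (ha0 : 0 ≤ a) (ha6 : a ≤ 6) (hb1 : e * a ≤ b) (hb2 : b ≤ 3 * (e + 2))
    (hchi : 2 * (a * b + a + b - c + 2) - e * a * (a + 1) ≥ 74) :
    ∀ p q a' b' c' : ℤ, p = ⌊(a : ℚ) / 2⌋ + 1 → q = ⌊(b : ℚ) / 2⌋ + 1 →
      a' = a - 2 * p → b' = b - 2 * q →
      c' = c + e * a * p - a * q - b * p - e * p ^ 2 + 2 * p * q →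
      c' ≤ -2 ∧ (c' = -2 → a' = -1) ∧ (c' ≥ -3 → b' = -2) := by
  intro p q a' b' c' hp hq ha' hb' hc'
  rw [floor_intCast_div_two] at hp hq
  rcases he with rfl | rfl | rfl | rfl <;> interval_cases a <;>
    norm_num at hp <;> subst hp <;> norm_num at hb1 hb2 hchi ha' hc' <;> omega
end

section
/- Let e ∈ {0, 2, 3, 4} and let a, b, c be integers with 0 ≤ a ≤ 6, ea ≤ b ≤ 3(e + 2), and 2(ab + a + b − c + 2) − ea(a + 1) ≥ 74. Set p = ⌊a/2⌋ + 1, q = ⌊b/2⌋ + 1, a' = a − 2p, b' = b − 2q, and c' = c + eap − aq − bp − ep² + 2pq. Then (2b' − ea')(a' + 1) + 2a' − 2c' + 4 > 0. -/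
theorem claim_surf_chi (e a b c : ℤ) (he : e = 0 ∨ e = 2 ∨ e = 3 ∨ e = 4)
    (ha0 : 0 ≤ a) (ha6 : a ≤ 6) (hb1 : e * a ≤ b) (hb2 : b ≤ 3 * (e + 2))
    (hchi : 2 * (a * b + a + b - c + 2) - e * a * (a + 1) ≥ 74) :
    ∀ p q a' b' c' : ℤ, p = ⌊(a : ℚ) / 2⌋ + 1 → q = ⌊(b : ℚ) / 2⌋ + 1 →
      a' = a - 2 * p → b' = b - 2 * q →
      c' = c + e * a * p - a * q - b * p - e * p ^ 2 + 2 * p * q →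
      (2 * b' - e * a') * (a' + 1) + 2 * a' - 2 * c' + 4 > 0 := by
  rintro p q a' b' c' hp hq rfl rfl rfl
  have floor_half (n : ℤ) : ⌊(n : ℚ) / 2⌋ = n / 2 := by
    exact_mod_cast Rat.floor_intCast_div_natCast n 2
  rw [floor_half] at hp hq
  subst hp
  obtain ⟨s, hs⟩ : ∃ s, s = b / 2 := ⟨_, rfl⟩
  rw [← hs] at hq
  subst hq
  rcases he with rfl | rfl | rfl | rfl <;> interval_cases a <;>
    norm_num at hb1 hb2 hchi ⊢ <;> ring_nf at hb1 hb2 hchi ⊢ <;> omega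
end

section
/- Let e ∈ {0, 2, 3, 4} and let a, b, c be integers with 0 ≤ a ≤ 6, ea ≤ b ≤ 3(e + 2), (a, b) ≠ (6, 3(e + 2)), and 2(ab + a + b − c + 2) − ea(a + 1) ≥ 72. Set p = ⌊a/2⌋ + 1, q = ⌊b/2⌋ + 1, and c' = c + eap − aq − bp − ep² + 2pq. Then c' ≤ −4, except possibly in the following cases: if (e, a, b) = (3, 5, 15) then c' ≤ −3; if (e, a, b) = (4, 5, 18) then c' ≤ −1; if (e, a, b) = (4, 3, 18) then c' ≤ −1; if (e, a, b) = (4, 4, 18) then c' ≤ −2. -/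
theorem claim_surf_c2_equality_case (e a b c : ℤ)
    (he : e = 0 ∨ e = 2 ∨ e = 3 ∨ e = 4)
    (ha0 : 0 ≤ a) (ha6 : a ≤ 6) (hb1 : e * a ≤ b) (hb2 : b ≤ 3 * (e + 2))
    (hne : ¬(a = 6 ∧ b = 3 * (e + 2)))
    (hchi : 2 * (a * b + a + b - c + 2) - e * a * (a + 1) ≥ 72) :
    ∀ p q c' : ℤ, p = ⌊(a : ℚ) / 2⌋ + 1 → q = ⌊(b : ℚ) / 2⌋ + 1 →
      c' = c + e * a * p - a * q - b * p - e * p ^ 2 + 2 * p * q →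
      (¬((e = 3 ∧ a = 5 ∧ b = 15) ∨ (e = 4 ∧ a = 5 ∧ b = 18) ∨
          (e = 4 ∧ a = 3 ∧ b = 18) ∨ (e = 4 ∧ a = 4 ∧ b = 18)) → c' ≤ -4) ∧
      ((e = 3 ∧ a = 5 ∧ b = 15) → c' ≤ -3) ∧
      ((e = 4 ∧ a = 5 ∧ b = 18) → c' ≤ -1) ∧
      ((e = 4 ∧ a = 3 ∧ b = 18) → c' ≤ -1) ∧
      ((e = 4 ∧ a = 4 ∧ b = 18) → c' ≤ -2) := by
  intro p q c' hp hq hc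
  have floor_half (n : ℤ) : ⌊(n : ℚ) / 2⌋ = n / 2 := by
    exact_mod_cast Rat.floor_intCast_div_natCast n 2
  rw [floor_half] at hp hq
  rcases he with rfl | rfl | rfl | rfl <;> interval_cases a <;> norm_num at hp <;> subst hp <;>
    norm_num at hne ⊢ <;> omega
end
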